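/- arXiv:2402.13986 — 2 statements merged into one kernel-verified Lean document; each statement's English description precedes it below -/
import Mathlib

section
/- For every α ∈ {1, −1} (where e_{−1} = e_{n−1} and −α denotes the other element of {1, −1}) and all x₁, x₂, x₃ ∈ sl₂(ℂ) one has e_α(x₁) · e_{−α}(x₂) · e_α(x₃) = e_α(x₃) · e_{−α}(x₂) · e_α(x₁). -/
open scoped BigOperators

/-- The algebra of `2 × 2` complex matrices. -/
abbrev M2 : Type := Matrix (Fin 2) (Fin 2) ℂ

/-- The diagonal matrix `D = diag(1, ω)`. -/
noncomputable def Dmat (ω : ℂ) : M2 := Matrix.diagonal ![1, ω]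

/-- The linear map `e_i : M₂(ℂ) → M₂(ℂ)`, `e_i(x) = (1/n) ∑_{j=0}^{n-1} ω^{-i j} D^j x D^{-j}`. -/
noncomputable def eM (n : ℕ) (ω : ℂ) (i : ℕ) (x : M2) : M2 :=
  (n : ℂ)⁻¹ • ∑ j ∈ Finset.range n, (ω ^ (i * j))⁻¹ • (Dmat ω ^ j * x * (Dmat ω ^ j)⁻¹)

/-- A geometric sum over a full period of a nontrivial `n`-th root of unity vanishes. -/
theorem sum_range_pow_eq_zero {K : Type*} [Field K] {n : ℕ} {r : K} (hr : r ^ n = 1)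
    (hr1 : r ≠ 1) : ∑ j ∈ Finset.range n, r ^ j = 0 := by
  rw [geom_sum_eq hr1, hr, sub_self, zero_div]

theorem Dmat_pow_inv {ω : ℂ} (hω : ω ≠ 0) (j : ℕ) :
    (Dmat ω ^ j)⁻¹ = Matrix.diagonal fun a => (![1, ω] a ^ j)⁻¹ := by
  refine Matrix.inv_eq_right_inv ?_
  rw [Dmat, Matrix.diagonal_pow, Matrix.diagonal_mul_diagonal, ← Matrix.diagonal_one]
  congr 1
  ext a
  fin_cases a <;> simp [hω]

theorem eM_apply (n : ℕ) {ω : ℂ} (hω : ω ≠ 0) (i : ℕ) (x : M2) (a b : Fin 2) :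
    eM n ω i x a b = (n : ℂ)⁻¹ *
      ((∑ j ∈ Finset.range n, ((ω ^ i)⁻¹ * ![1, ω] a * (![1, ω] b)⁻¹) ^ j) * x a b) := by
  rw [eM, Matrix.smul_apply, Matrix.sum_apply, smul_eq_mul, Finset.sum_mul]
  congr 1
  refine Finset.sum_congr rfl fun j _ => ?_
  rw [Dmat_pow_inv hω, Dmat, Matrix.diagonal_pow, Matrix.smul_apply, Matrix.mul_diagonal,
    Matrix.diagonal_mul, smul_eq_mul, Pi.pow_apply, mul_pow, mul_pow, inv_pow, inv_pow, pow_mul]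
  ring

theorem eM_apply_eq_zero {n : ℕ} {ω : ℂ} (hω : IsPrimitiveRoot ω n) (hn : n ≠ 0) {i : ℕ}
    (x : M2) {a b : Fin 2} (h : ![1, ω] a ≠ ω ^ i * ![1, ω] b) : eM n ω i x a b = 0 := by
  have h0 : ω ≠ 0 := hω.ne_zero hn
  have hd : ∀ c : Fin 2, ![1, ω] c ≠ 0 ∧ ![1, ω] c ^ n = 1 := by
    intro c
    fin_cases c <;> simp [h0, hω.pow_eq_one]
  rw [eM_apply n h0, sum_range_pow_eq_zero, zero_mul, mul_zero]
  · rw [mul_pow, mul_pow, inv_pow, inv_pow, (hd a).2, (hd b).2, ← pow_mul, mul_comm i n, pow_mul,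
      hω.pow_eq_one]
    simp
  · intro h1
    apply h
    have hb := (hd b).1
    have hi : ω ^ i ≠ 0 := pow_ne_zero i h0
    calc ![1, ω] a = ω ^ i * ![1, ω] b * ((ω ^ i)⁻¹ * ![1, ω] a * (![1, ω] b)⁻¹) := by
          field_simp
      _ = ω ^ i * ![1, ω] b := by rw [h1, mul_one]

/-- For `α ∈ {1, -1}` (with `e_{-1} = e_{n-1}` and `-α` the other element of `{1, -1}`) and all
`x₁, x₂, x₃ ∈ sl₂(ℂ)`, `e_α(x₁) e_{-α}(x₂) e_α(x₃) = e_α(x₃) e_{-α}(x₂) e_α(x₁)`. -/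
theorem e_alpha_sandwich (n : ℕ) (hn : 3 ≤ n) (ω : ℂ) (hω : IsPrimitiveRoot ω n)
    (α β : ℕ) (hαβ : (α = 1 ∧ β = n - 1) ∨ (α = n - 1 ∧ β = 1))
    (x₁ x₂ x₃ : M2) (hx₁ : Matrix.trace x₁ = 0) (hx₂ : Matrix.trace x₂ = 0)
    (hx₃ : Matrix.trace x₃ = 0) :
    eM n ω α x₁ * eM n ω β x₂ * eM n ω α x₃ = eM n ω α x₃ * eM n ω β x₂ * eM n ω α x₁ := by
  have hn0 : n ≠ 0 := by omega
  have h0 : ω ≠ 0 := hω.ne_zero hn0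
  have h1 : ω ≠ 1 := hω.ne_one (by omega)
  have h2 : ω * ω ≠ 1 := by
    rw [← sq]
    exact hω.pow_ne_one_of_pos_of_lt (by norm_num) (by omega)
  rcases hαβ with ⟨rfl, -⟩ | ⟨rfl, -⟩
  · have key : ∀ x : M2, eM n ω 1 x 0 0 = 0 ∧ eM n ω 1 x 0 1 = 0 ∧ eM n ω 1 x 1 1 = 0 :=
      fun x => ⟨eM_apply_eq_zero hω hn0 x (by simpa using h1.symm),
        eM_apply_eq_zero hω hn0 x (by simpa using h2.symm),
        eM_apply_eq_zero hω hn0 x (by simpa [h0] using h1)⟩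
    ext a b
    fin_cases a <;> fin_cases b <;> simp [Matrix.mul_apply, Fin.sum_univ_two, key]
    ring
  · have hp : ω ^ (n - 1) * ω = 1 := by
      rw [← pow_succ, Nat.sub_add_cancel (by omega), hω.pow_eq_one]
    have hp1 : ω ^ (n - 1) ≠ 1 := fun h => h1 (by simpa [h] using hp)
    have hp2 : ω ≠ ω ^ (n - 1) := fun h => h2 (by rwa [← h] at hp)
    have key : ∀ x : M2, eM n ω (n - 1) x 0 0 = 0 ∧ eM n ω (n - 1) x 1 0 = 0 ∧
        eM n ω (n - 1) x 1 1 = 0 :=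
      fun x => ⟨eM_apply_eq_zero hω hn0 x (by simpa using hp1.symm),
        eM_apply_eq_zero hω hn0 x (by simpa using hp2),
        eM_apply_eq_zero hω hn0 x (by simpa [hp] using h1)⟩
    ext a b
    fin_cases a <;> fin_cases b <;> simp [Matrix.mul_apply, Fin.sum_univ_two, key]
    ring
end

section
/- For all α, β ∈ {1, 2, 3} and all x₁, x₂ ∈ sl₂(ℂ): (a) ε_{1α}(x₁) · ε_{jβ}(x₂) = ε_{1β}(x₂) · ε_{jα}(x₁) for each j ∈ {2, 3}; (b) ε_{2α}(x₁) · ε_{3β}(x₂) = ε_{2β}(x₂) · ε_{3α}(x₁). -/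
/-- The basis `v₁ = e₁₁ - e₂₂`, `v₂ = e₁₂`, `v₃ = e₂₁` of `sl₂(ℂ)` (indexed by `Fin 3`). -/
noncomputable def vB : Fin 3 → M2 := ![!![1, 0; 0, -1], !![0, 1; 0, 0], !![0, 0; 1, 0]]

/-- The coordinates of a traceless matrix with respect to the basis `vB`. -/
def vCoord (x : M2) : Fin 3 → ℂ := ![x 0 0, x 0 1, x 1 0]

theorem sum_vCoord_smul_vB {x : M2} (hx : Matrix.trace x = 0) :
    ∑ k, vCoord x k • vB k = x := by
  rw [Matrix.trace_fin_two] at hx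
  ext a b
  fin_cases a <;> fin_cases b <;>
    simp [Fin.sum_univ_three, vCoord, vB, eq_neg_of_add_eq_zero_right hx]

theorem apply_eq_vCoord_smul_vB {f : M2 →ₗ[ℂ] M2} {i j : Fin 3}
    (hf : ∀ k, f (vB k) = if j = k then vB i else 0) {x : M2} (hx : Matrix.trace x = 0) :
    f x = vCoord x j • vB i := by
  conv_lhs => rw [← sum_vCoord_smul_vB hx]
  simp [hf]

/-- With `ε_{ij}` (here `E i j`, indices shifted down by one to `Fin 3`) the `ℂ`-linear maps
determined by `ε_{ij}(v_k) = δ_{jk} v_i`: for all `α, β ∈ {1,2,3}` and `x₁, x₂ ∈ sl₂(ℂ)`: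
(a) `ε_{1α}(x₁) ε_{jβ}(x₂) = ε_{1β}(x₂) ε_{jα}(x₁)` for each `j ∈ {2,3}`;
(b) `ε_{2α}(x₁) ε_{3β}(x₂) = ε_{2β}(x₂) ε_{3α}(x₁)`. -/
theorem eps_swap_variables (E : Fin 3 → Fin 3 → (M2 →ₗ[ℂ] M2))
    (hE : ∀ i j k : Fin 3, E i j (vB k) = if j = k then vB i else 0)
    (α β : Fin 3)
    (x₁ x₂ : M2) (hx₁ : Matrix.trace x₁ = 0) (hx₂ : Matrix.trace x₂ = 0) :
    (∀ j : Fin 3, j = 1 ∨ j = 2 → E 0 α x₁ * E j β x₂ = E 0 β x₂ * E j α x₁) ∧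
    E 1 α x₁ * E 2 β x₂ = E 1 β x₂ * E 2 α x₁ := by
  have hE₁ (i j : Fin 3) := apply_eq_vCoord_smul_vB (hE i j) hx₁
  have hE₂ (i j : Fin 3) := apply_eq_vCoord_smul_vB (hE i j) hx₂
  have swap (i j : Fin 3) : E i α x₁ * E j β x₂ = E i β x₂ * E j α x₁ := by
    simp only [hE₁, hE₂, smul_mul_smul_comm, mul_comm (vCoord x₁ α)]
  exact ⟨fun j _ => swap 0 j, swap 1 2⟩
end
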